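/- Let ξ, η ∈ ℝ³ with ξ ≠ 0, η ≠ 0 and ξ − η ≠ 0. Then (S_η Φ(ξ,η))² + (Ω_η Φ(ξ,η))² = ‖σ̄(ξ,η)‖² · ‖ξ_h − η_h‖² / ‖ξ−η‖⁶. Consequently, writing R = ‖σ̄(ξ,η)‖ · ‖ξ_h − η_h‖ / ‖ξ−η‖³, one has R ≤ |S_η Φ(ξ,η)| + |Ω_η Φ(ξ,η)| ≤ √2 · R. -/

import Mathlib

/-- Euclidean norm on `ℝ³`. -/
noncomputable def nrm (ξ : Fin 3 → ℝ) : ℝ := Real.sqrt (ξ 0 ^ 2 + ξ 1 ^ 2 + ξ 2 ^ 2)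

/-- The dispersion relation `Λ(ξ) = ξ₃ / ‖ξ‖`. -/
noncomputable def Lam (ξ : Fin 3 → ℝ) : ℝ := ξ 2 / nrm ξ

/-- The phase `Φ(ξ,η) = Λ(ξ) + Λ(ξ−η) + ν Λ(η)`. -/
noncomputable def Phi (ν : ℝ) (ξ η : Fin 3 → ℝ) : ℝ := Lam ξ + Lam (ξ - η) + ν * Lam η

/-- Scaling vector field `S_η f = η · ∇_η f`. -/
noncomputable def SV (f : (Fin 3 → ℝ) → ℝ) : (Fin 3 → ℝ) → ℝ := fun η => fderiv ℝ f η η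

/-- Rotation vector field `Ω_η f = −η₂ ∂_{η₁} f + η₁ ∂_{η₂} f`. -/
noncomputable def OV (f : (Fin 3 → ℝ) → ℝ) : (Fin 3 → ℝ) → ℝ :=
  fun η => fderiv ℝ f η ![-(η 1), η 0, 0]

theorem nrm_sq (ζ : Fin 3 → ℝ) : nrm ζ ^ 2 = ζ 0 ^ 2 + ζ 1 ^ 2 + ζ 2 ^ 2 :=
  Real.sq_sqrt (by positivity)

theorem sum_sq_pos {ζ : Fin 3 → ℝ} (hζ : ζ ≠ 0) : 0 < ζ 0 ^ 2 + ζ 1 ^ 2 + ζ 2 ^ 2 := by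
  by_contra! h
  apply hζ
  ext i
  fin_cases i <;> simp <;> nlinarith [sq_nonneg (ζ 0), sq_nonneg (ζ 1), sq_nonneg (ζ 2)]

theorem nrm_pos {ζ : Fin 3 → ℝ} (hζ : ζ ≠ 0) : 0 < nrm ζ :=
  Real.sqrt_pos.2 (sum_sq_pos hζ)

theorem differentiableAt_Lam {ζ : Fin 3 → ℝ} (hζ : ζ ≠ 0) : DifferentiableAt ℝ Lam ζ := by
  have h : DifferentiableAt ℝ nrm ζ := by
    unfold nrm
    exact DifferentiableAt.sqrt (by fun_prop) (sum_sq_pos hζ).ne'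
  unfold Lam
  exact DifferentiableAt.fun_mul (by fun_prop) (h.fun_inv (nrm_pos hζ).ne')

/-- The directional derivative of `Λ` at a nonzero point. -/
theorem fderiv_Lam {ζ : Fin 3 → ℝ} (hζ : ζ ≠ 0) (v : Fin 3 → ℝ) :
    fderiv ℝ Lam ζ v =
      (v 2 * nrm ζ ^ 2 - ζ 2 * (ζ 0 * v 0 + ζ 1 * v 1 + ζ 2 * v 2)) / nrm ζ ^ 3 := by
  have hn := nrm_pos hζ
  have hp (i : Fin 3) : HasFDerivAt (fun x : Fin 3 → ℝ => x i)
      (ContinuousLinearMap.proj (R := ℝ) (φ := fun _ : Fin 3 => ℝ) i) ζ := hasFDerivAt_apply i ζ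
  have hs : HasFDerivAt nrm _ ζ :=
    ((((hp 0).pow 2).add ((hp 1).pow 2)).add ((hp 2).pow 2)).sqrt (sum_sq_pos hζ).ne'
  have hL : HasFDerivAt Lam _ ζ := (hp 2).mul ((hasDerivAt_inv hn.ne').comp_hasFDerivAt ζ hs)
  rw [hL.fderiv]
  simp only [Pi.add_apply]
  rw [show √(ζ 0 ^ 2 + ζ 1 ^ 2 + ζ 2 ^ 2) = nrm ζ from rfl]
  simp
  field_simp
  ring

theorem fderiv_Phi (ν : ℝ) {ξ η : Fin 3 → ℝ} (hη : η ≠ 0) (hξη : ξ - η ≠ 0) (v : Fin 3 → ℝ) :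
    fderiv ℝ (Phi ν ξ) η v = -fderiv ℝ Lam (ξ - η) v + ν * fderiv ℝ Lam η v := by
  have h₁ : HasFDerivAt (fun x => Lam (ξ - x)) _ η :=
    (differentiableAt_Lam hξη).hasFDerivAt.comp η ((hasFDerivAt_id η).const_sub ξ)
  have h : HasFDerivAt (Phi ν ξ) _ η :=
    (h₁.const_add (Lam ξ)).add ((differentiableAt_Lam hη).hasFDerivAt.const_mul ν)
  rw [h.fderiv]
  simp

/-- `S_η Φ = σ̄ · (ξ_h - η_h) / ‖ξ - η‖³`. -/
theorem SV_Phi (ν : ℝ) {ξ η : Fin 3 → ℝ} (hη : η ≠ 0) (hξη : ξ - η ≠ 0) :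
    SV (Phi ν ξ) η = ((ξ 2 * η 0 - η 2 * ξ 0) * (ξ 0 - η 0) +
      (ξ 2 * η 1 - η 2 * ξ 1) * (ξ 1 - η 1)) / nrm (ξ - η) ^ 3 := by
  rw [SV, fderiv_Phi ν hη hξη, fderiv_Lam hξη, fderiv_Lam hη, nrm_sq, nrm_sq]
  simp only [Pi.sub_apply]
  ring

/-- `Ω_η Φ = -σ̄ · (ξ_h - η_h)^⊥ / ‖ξ - η‖³`. -/
theorem OV_Phi (ν : ℝ) {ξ η : Fin 3 → ℝ} (hη : η ≠ 0) (hξη : ξ - η ≠ 0) :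
    OV (Phi ν ξ) η = ((ξ 2 * η 0 - η 2 * ξ 0) * (ξ 1 - η 1) -
      (ξ 2 * η 1 - η 2 * ξ 1) * (ξ 0 - η 0)) / nrm (ξ - η) ^ 3 := by
  rw [OV, fderiv_Phi ν hη hξη, fderiv_Lam hξη, fderiv_Lam hη]
  simp
  ring

/-- Comparison of the `ℓ¹` and `ℓ²` norms on `ℝ²`. -/
theorem le_abs_add_abs_le_of_sq_add_sq {a b R : ℝ} (hR : 0 ≤ R) (h : a ^ 2 + b ^ 2 = R ^ 2) :
    R ≤ |a| + |b| ∧ |a| + |b| ≤ √2 * R := by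
  have ha := abs_nonneg a
  have hb := abs_nonneg b
  rw [← sq_abs a, ← sq_abs b] at h
  constructor
  · refine (sq_le_sq₀ (by positivity) (by positivity)).1 ?_
    nlinarith [mul_nonneg ha hb]
  · refine (sq_le_sq₀ (by positivity) (by positivity)).1 ?_
    rw [mul_pow, Real.sq_sqrt zero_le_two]
    nlinarith [sq_nonneg (|a| - |b|)]

/-- `(S_ηΦ)² + (Ω_ηΦ)² = ‖σ̄‖²‖ξ_h−η_h‖²/‖ξ−η‖⁶`, and with
`R = ‖σ̄‖‖ξ_h−η_h‖/‖ξ−η‖³` one has `R ≤ |S_ηΦ|+|Ω_ηΦ| ≤ √2·R`. -/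
theorem stmt4 (ν : ℝ) (hν : ν = 1 ∨ ν = -1) (ξ η : Fin 3 → ℝ)
    (hξ : ξ ≠ 0) (hη : η ≠ 0) (hξη : ξ - η ≠ 0) :
    SV (Phi ν ξ) η ^ 2 + OV (Phi ν ξ) η ^ 2 =
      ((ξ 2 * η 0 - η 2 * ξ 0) ^ 2 + (ξ 2 * η 1 - η 2 * ξ 1) ^ 2) *
        ((ξ 0 - η 0) ^ 2 + (ξ 1 - η 1) ^ 2) / nrm (ξ - η) ^ 6 ∧
    ∀ R : ℝ,
      R = Real.sqrt ((ξ 2 * η 0 - η 2 * ξ 0) ^ 2 + (ξ 2 * η 1 - η 2 * ξ 1) ^ 2) *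
          Real.sqrt ((ξ 0 - η 0) ^ 2 + (ξ 1 - η 1) ^ 2) / nrm (ξ - η) ^ 3 →
      R ≤ |SV (Phi ν ξ) η| + |OV (Phi ν ξ) η| ∧
        |SV (Phi ν ξ) η| + |OV (Phi ν ξ) η| ≤ Real.sqrt 2 * R := by
  have key : SV (Phi ν ξ) η ^ 2 + OV (Phi ν ξ) η ^ 2 =
      ((ξ 2 * η 0 - η 2 * ξ 0) ^ 2 + (ξ 2 * η 1 - η 2 * ξ 1) ^ 2) *
        ((ξ 0 - η 0) ^ 2 + (ξ 1 - η 1) ^ 2) / nrm (ξ - η) ^ 6 := by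
    rw [SV_Phi ν hη hξη, OV_Phi ν hη hξη]
    ring
  refine ⟨key, ?_⟩
  rintro R rfl
  have hn := nrm_pos hξη
  apply le_abs_add_abs_le_of_sq_add_sq (by positivity)
  rw [key, div_pow, mul_pow, Real.sq_sqrt (by positivity), Real.sq_sqrt (by positivity), ← pow_mul]
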